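/- arXiv:2603.20717 — 2 statements merged into one kernel-verified Lean document; each statement's English description precedes it below -/
import Mathlib

section
/- The 9×9 diagonal matrix (1/57)·diag(8, 8, 8, 8, 8, 8, 4, 4, 1) is an extreme point of AP_{3,3}. -/
open Matrix ComplexOrder

noncomputable section

/-- Index type for a two-qutrit system. -/
abbrev QIdx : Type := Fin 3 × Fin 3

/-- Partial transpose: `PT M ((i,j),(k,l)) = M ((i,l),(k,j))`. -/
def PT (M : Matrix QIdx QIdx ℂ) : Matrix QIdx QIdx ℂ :=
  fun p q => M (p.1, q.2) (q.1, p.2)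

/-- The set of absolutely PPT two-qutrit states. -/
def AP33 : Set (Matrix QIdx QIdx ℂ) :=
  {ρ | ρ.PosSemidef ∧ ρ.trace = 1 ∧
    ∀ U : Matrix QIdx QIdx ℂ, U ∈ Matrix.unitaryGroup QIdx ℂ →
      (PT (U * ρ * Uᴴ)).PosSemidef}

/-- The 9×9 diagonal matrix with prescribed real diagonal entries
(listed in order), regarded as a matrix indexed by `QIdx`. -/
def diag9 (d : Fin 9 → ℝ) : Matrix QIdx QIdx ℂ :=
  Matrix.diagonal fun p => ((d ((finProdFinEquiv.trans (finCongr (by norm_num))) p) : ℝ) : ℂ)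

theorem Matrix.submatrix_id_equiv_mem_unitaryGroup {m : Type*} [Fintype m] [DecidableEq m]
    {U : Matrix m m ℂ} (hU : U ∈ unitaryGroup m ℂ) (e : m ≃ m) :
    U.submatrix id e ∈ unitaryGroup m ℂ := by
  rw [mem_unitaryGroup_iff] at hU ⊢
  rw [star_eq_conjTranspose, conjTranspose_submatrix, submatrix_mul_equiv, ← star_eq_conjTranspose,
    hU, submatrix_id_id]

theorem Matrix.IsHermitian.exists_unitary_diagonal_antitone {n : ℕ}
    {A : Matrix (Fin n) (Fin n) ℂ} (hA : A.IsHermitian) :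
    ∃ Q ∈ unitaryGroup (Fin n) ℂ, ∃ d : Fin n → ℝ, Antitone d ∧
      Qᴴ * A * Q = diagonal fun i => (d i : ℂ) := by
  set e : Fin n ≃ Fin n := Tuple.sort (fun i => -hA.eigenvalues i) with he
  have hmono : Monotone ((fun i => -hA.eigenvalues i) ∘ e) := Tuple.monotone_sort _
  refine ⟨_, submatrix_id_equiv_mem_unitaryGroup hA.eigenvectorUnitary.2 e,
    fun i => hA.eigenvalues (e i), fun i j hij => by simpa using hmono hij, ?_⟩
  have h := hA.conjStarAlgAut_star_eigenvectorUnitary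
  rw [Unitary.conjStarAlgAut_star_apply] at h
  have h2 : ((hA.eigenvectorUnitary : Matrix (Fin n) (Fin n) ℂ)ᴴ.submatrix e id) * A *
      ((hA.eigenvectorUnitary : Matrix (Fin n) (Fin n) ℂ).submatrix id e) =
      ((star (hA.eigenvectorUnitary : Matrix (Fin n) (Fin n) ℂ)) * A *
        (hA.eigenvectorUnitary : Matrix (Fin n) (Fin n) ℂ)).submatrix e e := by
    ext i j
    simp [Matrix.mul_apply, star_eq_conjTranspose]
  rw [conjTranspose_submatrix, h2, h, submatrix_diagonal_equiv]
  rfl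

theorem Matrix.exists_singular_value_decomposition {n : ℕ} (X : Matrix (Fin n) (Fin n) ℂ) :
    ∃ P ∈ unitaryGroup (Fin n) ℂ, ∃ R ∈ unitaryGroup (Fin n) ℂ, ∃ s : Fin n → ℝ,
      Antitone s ∧ (∀ i, 0 ≤ s i) ∧ X = P * diagonal (fun i => (s i : ℂ)) * R := by
  obtain ⟨Q, hQ, d, hd, hdiag⟩ :=
    (posSemidef_conjTranspose_mul_self X).isHermitian.exists_unitary_diagonal_antitone
  set Y := X * Q with hY
  have hYY : Yᴴ * Y = diagonal fun i => (d i : ℂ) := by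
    rw [← hdiag, hY, conjTranspose_mul]; simp only [Matrix.mul_assoc]
  have hd0 : ∀ i, 0 ≤ d i := by
    have h := posSemidef_conjTranspose_mul_self Y
    rw [hYY, posSemidef_diagonal_iff] at h
    intro i
    exact_mod_cast h i
  set s : Fin n → ℝ := fun i => √(d i) with hs
  have hentry : ∀ a b, ∑ i, star (Y i a) * Y i b = if a = b then (d a : ℂ) else 0 := by
    intro a b
    have h := congrFun (congrFun hYY a) b
    rw [diagonal_apply] at h
    rw [← h, mul_apply]
    simp
  set v : Fin n → EuclideanSpace ℂ (Fin n) :=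
    fun a => WithLp.toLp 2 fun i => (s a : ℂ)⁻¹ * Y i a with hv
  have horth : Orthonormal ℂ (Set.domRestrict {a | s a ≠ 0} v) := by
    rw [orthonormal_iff_ite]
    rintro ⟨a, ha⟩ ⟨b, hb⟩
    have hsa : (s a : ℂ) ≠ 0 := by exact_mod_cast ha
    have hsd : (d a : ℂ) = s a * s a := by
      rw [hs]; exact_mod_cast (Real.mul_self_sqrt (hd0 a)).symm
    have h1 : inner ℂ (v a) (v b) = (s a : ℂ)⁻¹ * (s b : ℂ)⁻¹ * ∑ i, star (Y i a) * Y i b := by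
      simp only [hv, PiLp.inner_apply, RCLike.inner_apply, Finset.mul_sum]
      refine Finset.sum_congr rfl fun i _ => ?_
      simp
      ring
    simp only [Set.domRestrict_apply, Subtype.mk.injEq]
    rw [h1, hentry]
    split_ifs with h
    · subst h
      rw [hsd]
      field_simp
    · simp
  obtain ⟨b, hb⟩ := horth.exists_orthonormalBasis_extension_of_card_eq (by simp)
  refine ⟨(EuclideanSpace.basisFun (Fin n) ℂ).toBasis.toMatrix b.toBasis,
    (EuclideanSpace.basisFun (Fin n) ℂ).toMatrix_orthonormalBasis_mem_unitary b, Qᴴ,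
    Unitary.star_mem hQ, s, fun i j hij => Real.sqrt_le_sqrt (hd hij),
    fun i => Real.sqrt_nonneg _, ?_⟩
  have hYP : Y = (EuclideanSpace.basisFun (Fin n) ℂ).toBasis.toMatrix b.toBasis *
      diagonal (fun i => (s i : ℂ)) := by
    ext i a
    rw [mul_diagonal]
    have hE : (EuclideanSpace.basisFun (Fin n) ℂ).toBasis.toMatrix b.toBasis i a = b a i := rfl
    rw [hE]
    by_cases ha : s a = 0
    · have hda : d a = 0 := by
        have := Real.mul_self_sqrt (hd0 a)
        simp only [hs] at ha
        rw [ha] at this; linarith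
      have h := hentry a a
      rw [if_pos rfl, hda] at h
      have h2 : ∑ i, ‖Y i a‖ ^ 2 = 0 := by
        have : ((∑ i, ‖Y i a‖ ^ 2 : ℝ) : ℂ) = 0 := by
          rw [← Complex.ofReal_zero, ← h]
          push_cast
          refine Finset.sum_congr rfl fun i _ => ?_
          exact (Complex.conj_mul' _).symm
        exact_mod_cast this
      rw [Finset.sum_eq_zero_iff_of_nonneg (fun _ _ => by positivity)] at h2
      have := h2 i (Finset.mem_univ i)
      have : Y i a = 0 := by simpa using this
      simp [this, ha]
    · rw [hb a ha]
      have hsa : (s a : ℂ) ≠ 0 := by exact_mod_cast ha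
      simp only [hv]
      field_simp
  rw [← hYP, hY, Matrix.mul_assoc, ← star_eq_conjTranspose, (mem_unitaryGroup_iff).1 hQ,
    Matrix.mul_one]

/-- The eigenvalues of the partial transpose of the rank one projection onto the vector
`∑ j, s j • e_j ⊗ e_j`. -/
def swapEig (s : Fin 3 → ℝ) (p : QIdx) : ℝ :=
  if p.1 ≤ p.2 then s p.1 * s p.2 else -(s p.1 * s p.2)

/-- The columns are orthonormal eigenvectors of the swap operator. The factor `(1 + i) / 2` has
modulus `1 / √2`. -/
def swapBasis : Matrix QIdx QIdx ℂ := fun p q =>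
  if q.1 = q.2 then (if p = q then 1 else 0)
  else if p = q then (if q.1 < q.2 then (1 + Complex.I) / 2 else -((1 + Complex.I) / 2))
  else if p = q.swap then (1 + Complex.I) / 2 else 0

/-- The partial transpose of the projection onto `∑ j, s j • e_j ⊗ e_j`. -/
def weightedSwap (s : Fin 3 → ℝ) : Matrix QIdx QIdx ℂ := fun p q =>
  if p.1 = q.2 ∧ p.2 = q.1 then (s p.1 * s p.2 : ℂ) else 0

theorem half_one_add_I_mul_conj : ((1 + Complex.I) / 2) * ((1 + -Complex.I) / 2) = 1 / 2 := by
  linear_combination (-1 / 4) * Complex.I_sq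

theorem sum_swapBasis_mul (p : QIdx) (f : QIdx → ℂ) :
    ∑ r, swapBasis p r * f r =
      if p.1 = p.2 then f p
      else if p.1 < p.2 then (1 + Complex.I) / 2 * (f p + f p.swap)
      else (1 + Complex.I) / 2 * (f p.swap - f p) := by
  obtain ⟨i, j⟩ := p
  fin_cases i <;> fin_cases j <;>
    simp [Fintype.sum_prod_type, Fin.sum_univ_three, swapBasis] <;> ring

theorem swapBasis_mul_diagonal (d : QIdx → ℂ) (p q : QIdx) :
    (swapBasis * diagonal d * swapBasisᴴ) p q =
      if p = q then (if p.1 = p.2 then d p else (d p + d p.swap) / 2)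
      else if p = q.swap then (if p.1 < p.2 then (d p - d p.swap) / 2 else (d p.swap - d p) / 2)
      else 0 := by
  have hk := half_one_add_I_mul_conj
  have hrow : (swapBasis * diagonal d * swapBasisᴴ) p q =
      ∑ r, swapBasis p r * (d r * star (swapBasis q r)) := by
    rw [mul_apply]
    simp only [mul_diagonal, conjTranspose_apply, mul_assoc]
  rw [hrow, sum_swapBasis_mul]
  obtain ⟨i, j⟩ := p
  obtain ⟨k, l⟩ := q
  fin_cases i <;> fin_cases j <;> fin_cases k <;> fin_cases l <;> simp [swapBasis] <;>
    first
      | done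
      | linear_combination (d (0, 1) + d (1, 0)) * hk
      | linear_combination (d (0, 2) + d (2, 0)) * hk
      | linear_combination (d (1, 2) + d (2, 1)) * hk
      | linear_combination (d (0, 1) - d (1, 0)) * hk
      | linear_combination (d (0, 2) - d (2, 0)) * hk
      | linear_combination (d (1, 2) - d (2, 1)) * hk

theorem swapBasis_mem_unitaryGroup : swapBasis ∈ unitaryGroup QIdx ℂ := by
  rw [mem_unitaryGroup_iff, star_eq_conjTranspose]
  ext p q
  have h := swapBasis_mul_diagonal (fun _ => 1) p q
  rw [diagonal_one, Matrix.mul_one] at h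
  rw [h, one_apply]
  simp only [sub_self, zero_div, ite_self]
  norm_num

theorem swapBasis_diagonalizes (s : Fin 3 → ℝ) :
    swapBasis * diagonal (fun p => (swapEig s p : ℂ)) * swapBasisᴴ = weightedSwap s := by
  ext p q
  rw [swapBasis_mul_diagonal]
  obtain ⟨i, j⟩ := p
  obtain ⟨k, l⟩ := q
  simp only [weightedSwap, swapEig]
  fin_cases i <;> fin_cases j <;> fin_cases k <;> fin_cases l <;> simp <;> ring

theorem dotProduct_PT_mulVec (σ : Matrix QIdx QIdx ℂ) (w : QIdx → ℂ) :
    star w ⬝ᵥ (PT σ *ᵥ w) = (σ * PT (vecMulVec w (star w))).trace := by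
  simp only [dotProduct, mulVec, trace, diag, mul_apply, PT, vecMulVec_apply, Pi.star_apply,
    Fintype.sum_prod_type, Finset.mul_sum]
  refine Finset.sum_congr rfl fun i _ => ?_
  have hcomm : ∀ F : Fin 3 → Fin 3 → Fin 3 → ℂ,
      ∑ j, ∑ k, ∑ l, F j k l = ∑ l, ∑ k, ∑ j, F j k l := fun F => by
    rw [Finset.sum_congr rfl fun j _ => Finset.sum_comm, Finset.sum_comm]
    exact Finset.sum_congr rfl fun l _ => Finset.sum_comm
  rw [hcomm]
  refine Finset.sum_congr rfl fun l _ => Finset.sum_congr rfl fun k _ =>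
    Finset.sum_congr rfl fun j _ => ?_
  ring

open scoped Kronecker in
theorem PT_vecMulVec_svd (P R : Matrix (Fin 3) (Fin 3) ℂ) (s : Fin 3 → ℝ) :
    PT (vecMulVec (fun p => (P * diagonal (fun i => (s i : ℂ)) * R) p.1 p.2)
      (star fun p => (P * diagonal (fun i => (s i : ℂ)) * R) p.1 p.2)) =
      (P ⊗ₖ Rᴴ) * weightedSwap s * (P ⊗ₖ Rᴴ)ᴴ := by
  ext p q
  simp only [PT, vecMulVec_apply, Pi.star_apply, mul_apply, kroneckerMap_apply,
    weightedSwap, conjTranspose_apply, Fintype.sum_prod_type, Fin.sum_univ_three]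
  simp
  ring

open scoped Kronecker in
theorem exists_unitary_PT_vecMulVec (w : QIdx → ℂ) :
    ∃ V ∈ unitaryGroup QIdx ℂ, ∃ s : Fin 3 → ℝ, Antitone s ∧ (∀ i, 0 ≤ s i) ∧
      PT (vecMulVec w (star w)) = V * diagonal (fun p => (swapEig s p : ℂ)) * Vᴴ := by
  obtain ⟨P, hP, R, hR, s, hs, hs0, hX⟩ :=
    Matrix.exists_singular_value_decomposition (fun i j => w (i, j))
  refine ⟨(P ⊗ₖ Rᴴ) * swapBasis,
    mul_mem (kronecker_mem_unitary hP (Unitary.star_mem hR)) swapBasis_mem_unitaryGroup,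
    s, hs, hs0, ?_⟩
  have h := PT_vecMulVec_svd P R s
  rw [← hX] at h
  rw [conjTranspose_mul]
  calc _ = (P ⊗ₖ Rᴴ) * weightedSwap s * (P ⊗ₖ Rᴴ)ᴴ := h
    _ = _ := by rw [← swapBasis_diagonalizes]; simp only [Matrix.mul_assoc]

theorem trace_diagonal_mul_conj_diagonal (a b : QIdx → ℝ) (T : Matrix QIdx QIdx ℂ) :
    (diagonal (fun p => (a p : ℂ)) * (T * diagonal (fun p => (b p : ℂ)) * Tᴴ)).trace =
      ((∑ q, ∑ p, a q * b p * Complex.normSq (T q p) : ℝ) : ℂ) := by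
  simp only [trace, diag, diagonal_mul]
  push_cast
  refine Finset.sum_congr rfl fun q _ => ?_
  rw [mul_apply, Finset.mul_sum]
  refine Finset.sum_congr rfl fun p _ => ?_
  rw [mul_diagonal, conjTranspose_apply, Complex.star_def, Complex.normSq_eq_conj_mul_self]
  ring

theorem sum_normSq_row {T : Matrix QIdx QIdx ℂ} (hT : T ∈ unitaryGroup QIdx ℂ) (q : QIdx) :
    ∑ p, Complex.normSq (T q p) = 1 := by
  have h := congrFun (congrFun (mem_unitaryGroup_iff.1 hT) q) q
  rw [mul_apply, one_apply_eq] at h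
  have h2 : ((∑ p, Complex.normSq (T q p) : ℝ) : ℂ) = 1 := by
    rw [← h]
    push_cast
    exact Finset.sum_congr rfl fun p _ => (Complex.mul_conj _).symm
  exact_mod_cast h2

theorem sum_normSq_col {T : Matrix QIdx QIdx ℂ} (hT : T ∈ unitaryGroup QIdx ℂ) (p : QIdx) :
    ∑ q, Complex.normSq (T q p) = 1 := by
  have h := sum_normSq_row (Unitary.star_mem hT) p
  simpa [star_apply] using h

/-- The spectrum `(8, 8, 8, 8, 8, 8, 4, 4, 1)`. -/
def spec (p : QIdx) : ℝ := if p.1 ≠ 2 then 8 else if p.2 = 2 then 1 else 4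

theorem smul_diag9_eq_diagonal :
    ((1 : ℝ) / 57) • diag9 ![8, 8, 8, 8, 8, 8, 4, 4, 1] =
      diagonal fun p => ((spec p / 57 : ℝ) : ℂ) := by
  ext p q
  by_cases h : p = q
  · subst h
    obtain ⟨i, j⟩ := p
    fin_cases i <;> fin_cases j <;> simp [diag9, spec, finProdFinEquiv] <;>
      norm_num [div_eq_inv_mul]
  · simp [diag9, h]

theorem sum_swapEig_mul_le {s : Fin 3 → ℝ} (hs : Antitone s) (hs0 : ∀ i, 0 ≤ s i) {t : ℝ}
    (ht1 : s 1 * s 1 ≤ t) (ht2 : s 0 * s 2 ≤ t) (ht3 : t ≤ s 0 * s 1)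
    {m : QIdx → ℝ} (hm0 : ∀ p, 0 ≤ m p) (hm1 : ∀ p, m p ≤ 1) (hm : ∑ p, m p = 3) :
    ∑ p, swapEig s p * m p ≤ s 0 * s 0 + s 0 * s 1 + t := by
  have h01 : s 1 ≤ s 0 := hs (by decide)
  have h12 : s 2 ≤ s 1 := hs (by decide)
  have h0 := hs0 0
  have h1 := hs0 1
  have h2 := hs0 2
  have key : ∀ p, swapEig s p * m p ≤ t * m p + (if p = (0, 0) then s 0 * s 0 - t else 0) +
      (if p = (0, 1) then s 0 * s 1 - t else 0) := by
    have hsmall : ∀ p, swapEig s p ≤ t → swapEig s p * m p ≤ t * m p := fun p h =>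
      mul_le_mul_of_nonneg_right h (hm0 p)
    have ht0 : 0 ≤ t := le_trans (by positivity) ht1
    rintro ⟨i, j⟩
    fin_cases i <;> fin_cases j
    · have := hm1 (0, 0)
      have h3 : 0 ≤ s 0 * s 0 - t := by nlinarith
      simp [swapEig]
      nlinarith
    · have := hm1 (0, 1)
      have h3 : 0 ≤ s 0 * s 1 - t := by linarith
      simp [swapEig]
      nlinarith
    all_goals
      simp
      apply hsmall
      simp [swapEig]
      nlinarith [mul_nonneg h0 h1, mul_nonneg h0 h2, mul_nonneg h1 h2]
  calc ∑ p, swapEig s p * m p ≤ ∑ p, (t * m p + (if p = (0, 0) then s 0 * s 0 - t else 0) +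
      (if p = (0, 1) then s 0 * s 1 - t else 0)) := Finset.sum_le_sum fun p _ => key p
    _ = _ := by
      rw [Finset.sum_add_distrib, Finset.sum_add_distrib, ← Finset.mul_sum, hm]
      simp
      ring

theorem weighted_sum_swapEig_le {s : Fin 3 → ℝ} (hs : Antitone s) (hs0 : ∀ i, 0 ≤ s i)
    {m n : QIdx → ℝ} (hm0 : ∀ p, 0 ≤ m p) (hm1 : ∀ p, m p ≤ 1) (hm : ∑ p, m p = 3)
    (hn0 : ∀ p, 0 ≤ n p) (hn : ∑ p, n p = 1) :
    4 * ∑ p, swapEig s p * m p + 3 * ∑ p, swapEig s p * n p ≤ 8 * ∑ p, swapEig s p := by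
  have h01 : s 1 ≤ s 0 := hs (by decide)
  have h12 : s 2 ≤ s 1 := hs (by decide)
  have h0 := hs0 0
  have h1 := hs0 1
  have h2 := hs0 2
  have hn' : ∑ p, swapEig s p * n p ≤ s 0 * s 0 := by
    calc _ ≤ ∑ p, s 0 * s 0 * n p := by
          refine Finset.sum_le_sum fun p _ => mul_le_mul_of_nonneg_right ?_ (hn0 p)
          have ha : s p.1 * s p.2 ≤ s 0 * s 0 :=
            mul_le_mul (hs (Fin.zero_le _)) (hs (Fin.zero_le _)) (hs0 _) h0
          have hb : 0 ≤ s p.1 * s p.2 := mul_nonneg (hs0 _) (hs0 _)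
          have hc : 0 ≤ s 0 * s 0 := mul_nonneg h0 h0
          unfold swapEig
          split_ifs <;> linarith
      _ = _ := by rw [← Finset.mul_sum, hn, mul_one]
  have hsum : ∑ p, swapEig s p = s 0 * s 0 + s 1 * s 1 + s 2 * s 2 := by
    simp [Fintype.sum_prod_type, Fin.sum_univ_three, swapEig]
    ring
  rw [hsum]
  rcases le_total (s 0 * s 2) (s 1 * s 1) with h | h
  · have := sum_swapEig_mul_le hs hs0 le_rfl h (by nlinarith) hm0 hm1 hm
    nlinarith [sq_nonneg (s 0 - 2 * s 1), sq_nonneg (s 2)]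
  · have := sum_swapEig_mul_le hs hs0 h le_rfl (by nlinarith) hm0 hm1 hm
    nlinarith [sq_nonneg (s 0 - 2 * s 1 - 2 * s 2), sq_nonneg (s 1 - s 2)]

theorem sum_spec_mul_swapEig_nonneg {s : Fin 3 → ℝ} (hs : Antitone s) (hs0 : ∀ i, 0 ≤ s i)
    {T : Matrix QIdx QIdx ℂ} (hT : T ∈ unitaryGroup QIdx ℂ) :
    0 ≤ ∑ q, ∑ p, spec q * swapEig s p * Complex.normSq (T q p) := by
  set f : QIdx → QIdx → ℝ := fun q p => Complex.normSq (T q p) with hf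
  have hrow : ∀ q, ∑ p, f q p = 1 := sum_normSq_row hT
  have hcol : ∀ p, ∑ q, f q p = 1 := sum_normSq_col hT
  have hf0 : ∀ q p, 0 ≤ f q p := fun q p => Complex.normSq_nonneg _
  have h := weighted_sum_swapEig_le hs hs0 (m := fun p => f (2, 0) p + f (2, 1) p + f (2, 2) p)
    (n := fun p => f (2, 2) p)
    (fun p => by have := hf0 (2, 0) p; have := hf0 (2, 1) p; have := hf0 (2, 2) p; positivity)
    (fun p => by
      have h := hcol p
      simp only [Fintype.sum_prod_type, Fin.sum_univ_three] at h
      have := hf0 (0, 0) p; have := hf0 (0, 1) p; have := hf0 (0, 2) p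
      have := hf0 (1, 0) p; have := hf0 (1, 1) p; have := hf0 (1, 2) p
      linarith)
    (by simp only [Finset.sum_add_distrib, hrow]; norm_num) (fun p => hf0 _ p) (hrow _)
  have hexp : ∑ q, ∑ p, spec q * swapEig s p * f q p =
      8 * ∑ p, swapEig s p - (4 * ∑ p, swapEig s p * (f (2, 0) p + f (2, 1) p + f (2, 2) p) +
        3 * ∑ p, swapEig s p * f (2, 2) p) := by
    rw [Finset.sum_comm, Finset.mul_sum, Finset.mul_sum, Finset.mul_sum,
      ← Finset.sum_add_distrib, ← Finset.sum_sub_distrib]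
    refine Finset.sum_congr rfl fun p _ => ?_
    have h := hcol p
    simp only [Fintype.sum_prod_type, Fin.sum_univ_three] at h ⊢
    simp [spec]
    linear_combination (8 * swapEig s p) * h
  rw [hexp]
  linarith

theorem Matrix.IsHermitian.PT {σ : Matrix QIdx QIdx ℂ} (hσ : σ.IsHermitian) :
    (PT σ).IsHermitian := by
  ext p q
  exact congrFun (congrFun hσ (p.1, q.2)) (q.1, p.2)

theorem smul_diag9_mem_AP33 :
    ((1 : ℝ) / 57) • diag9 ![8, 8, 8, 8, 8, 8, 4, 4, 1] ∈ AP33 := by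
  rw [smul_diag9_eq_diagonal]
  have hpos : (diagonal fun p => ((spec p / 57 : ℝ) : ℂ)).PosSemidef := by
    rw [posSemidef_diagonal_iff]
    intro p
    have : 0 ≤ spec p / 57 := by unfold spec; split_ifs <;> norm_num
    exact_mod_cast this
  refine ⟨hpos, ?_, fun U hU => ?_⟩
  · rw [trace_diagonal, ← Complex.ofReal_sum, ← Complex.ofReal_one]
    congr 1
    simp [Fintype.sum_prod_type, Fin.sum_univ_three, spec]
    norm_num
  · refine PosSemidef.of_dotProduct_mulVec_nonneg
      (hpos.mul_mul_conjTranspose_same U).isHermitian.PT fun w => ?_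
    obtain ⟨V, hV, s, hs, hs0, hw⟩ := exists_unitary_PT_vecMulVec w
    have hT : Uᴴ * V ∈ unitaryGroup QIdx ℂ := mul_mem (Unitary.star_mem hU) hV
    have htr : (U * diagonal (fun p => ((spec p / 57 : ℝ) : ℂ)) * Uᴴ *
        (V * diagonal (fun p => (swapEig s p : ℂ)) * Vᴴ)).trace =
        (diagonal (fun p => ((spec p / 57 : ℝ) : ℂ)) *
          ((Uᴴ * V) * diagonal (fun p => (swapEig s p : ℂ)) * (Uᴴ * V)ᴴ)).trace := by
      rw [Matrix.mul_assoc, Matrix.mul_assoc, trace_mul_comm]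
      simp only [conjTranspose_mul, conjTranspose_conjTranspose, Matrix.mul_assoc]
    rw [dotProduct_PT_mulVec, hw, htr, trace_diagonal_mul_conj_diagonal]
    rw [← Complex.ofReal_zero, Complex.real_le_real]
    have h := sum_spec_mul_swapEig_nonneg hs hs0 hT
    have h2 : ∑ q, ∑ p, spec q / 57 * swapEig s p * Complex.normSq ((Uᴴ * V) q p) =
        (∑ q, ∑ p, spec q * swapEig s p * Complex.normSq ((Uᴴ * V) q p)) / 57 := by
      simp only [Finset.sum_div]
      refine Finset.sum_congr rfl fun q _ => Finset.sum_congr rfl fun p _ => ?_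
      ring
    rw [h2]
    positivity

theorem trace_conj_nonneg_of_mem_AP33 {A : Matrix QIdx QIdx ℂ} (hA : A ∈ AP33) {d : QIdx → ℝ}
    {s : Fin 3 → ℝ} {e : Equiv.Perm QIdx} (hd : ∀ p, d p = swapEig s (e p))
    {V : Matrix QIdx QIdx ℂ} (hV : V ∈ unitaryGroup QIdx ℂ) :
    0 ≤ (A * (V * diagonal (fun p => (d p : ℂ)) * Vᴴ)).trace := by
  set W := swapBasis.submatrix id e with hW
  have hWu : W ∈ unitaryGroup QIdx ℂ :=
    submatrix_id_equiv_mem_unitaryGroup swapBasis_mem_unitaryGroup e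
  have hWs : Wᴴ * W = 1 := mem_unitaryGroup_iff'.1 hWu
  have hWd : W * diagonal (fun p => (d p : ℂ)) * Wᴴ = weightedSwap s := by
    have h : diagonal (fun p => (d p : ℂ)) =
        (diagonal fun p => (swapEig s p : ℂ)).submatrix e e := by
      rw [submatrix_diagonal_equiv]
      congr 1
      ext p
      simp [hd]
    rw [h, hW, conjTranspose_submatrix, submatrix_mul_equiv, submatrix_mul_equiv,
      swapBasis_diagonalizes, submatrix_id_id]
  have hw := PT_vecMulVec_svd 1 1 s
  simp only [conjTranspose_one, kroneckerMap_one_one, Matrix.one_mul,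
    mul_zero, zero_mul, mul_one, implies_true] at hw
  have h := (hA.2.2 _ (mul_mem hWu (Unitary.star_mem hV))).dotProduct_mulVec_nonneg
    (fun p => (diagonal (fun i => (s i : ℂ))) p.1 p.2)
  rw [dotProduct_PT_mulVec, hw, ← hWd] at h
  convert h using 1
  have h1 : W * star V * A * (W * star V)ᴴ * (W * diagonal (fun p => (d p : ℂ)) * Wᴴ) =
      W * (Vᴴ * A * V * (Wᴴ * W) * diagonal (fun p => (d p : ℂ)) * Wᴴ) := by
    simp only [star_eq_conjTranspose, conjTranspose_mul, conjTranspose_conjTranspose,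
      Matrix.mul_assoc]
  calc _ = (A * V * (diagonal (fun p => (d p : ℂ)) * Vᴴ)).trace := by simp only [Matrix.mul_assoc]
    _ = (Vᴴ * A * V * diagonal (fun p => (d p : ℂ)) * (Wᴴ * W)).trace := by
      rw [← Matrix.mul_assoc, trace_mul_comm, hWs, Matrix.mul_one]; simp only [Matrix.mul_assoc]
    _ = _ := by
      rw [h1, trace_mul_comm W, hWs, Matrix.mul_one]
      simp only [Matrix.mul_assoc, hWs, Matrix.mul_one]

section Perturbation

variable {ι : Type*} [Fintype ι] [DecidableEq ι]

theorem one_sub_smul_vecMulVec_mem_unitaryGroup {u : ι → ℂ} {c : ℝ}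
    (hc : (c : ℂ) * (star u ⬝ᵥ u) = 2) :
    1 - (c : ℂ) • vecMulVec u (star u) ∈ unitaryGroup ι ℂ := by
  rw [mem_unitaryGroup_iff, star_eq_conjTranspose, conjTranspose_sub, conjTranspose_one,
    conjTranspose_smul, conjTranspose_vecMulVec, star_star]
  have h : vecMulVec u (star u) * vecMulVec u (star u) =
      (star u ⬝ᵥ u) • vecMulVec u (star u) := by
    rw [vecMulVec_mul_vecMulVec]
    ext i j
    simp [vecMulVec_apply]
    ring
  rw [Complex.star_def, Complex.conj_ofReal, Matrix.sub_mul, Matrix.mul_sub, Matrix.mul_sub,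
    Matrix.one_mul, Matrix.mul_one, smul_mul_smul_comm, h, smul_smul, mul_assoc, hc]
  ext i j
  simp
  ring

theorem trace_mul_householder (A D : Matrix ι ι ℂ) (u : ι → ℂ) (c : ℂ) :
    (A * ((1 - c • vecMulVec u (star u)) * D * (1 - c • vecMulVec u (star u)))).trace =
      (A * D).trace - c * (star u ⬝ᵥ (D * A) *ᵥ u + star u ⬝ᵥ (A * D) *ᵥ u) +
        c ^ 2 * ((star u ⬝ᵥ D *ᵥ u) * (star u ⬝ᵥ A *ᵥ u)) := by
  set M := vecMulVec u (star u) with hM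
  have htr : ∀ B : Matrix ι ι ℂ, (B * M).trace = star u ⬝ᵥ B *ᵥ u := fun B => by
    rw [hM, mul_vecMulVec, trace_vecMulVec, dotProduct_comm]
  have hMDM : M * D * M = (star u ⬝ᵥ D *ᵥ u) • M := by
    rw [hM, Matrix.mul_assoc, mul_vecMulVec, vecMulVec_mul_vecMulVec]
    ext i j
    simp [vecMulVec_apply]
    ring
  have hexp : A * ((1 - c • M) * D * (1 - c • M)) =
      A * D - c • (A * (M * D)) - c • (A * D * M) + c ^ 2 • (A * (M * D * M)) := by
    simp only [Matrix.sub_mul, Matrix.mul_sub, Matrix.one_mul, Matrix.mul_one, smul_mul_assoc,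
      mul_smul_comm, Matrix.mul_assoc, smul_sub, smul_smul, pow_two]
    abel
  rw [hexp, hMDM, trace_add, trace_sub, trace_sub, trace_smul, trace_smul, trace_smul,
    mul_smul_comm, trace_smul, htr, htr, trace_mul_comm A (M * D), Matrix.mul_assoc M,
    trace_mul_comm M, htr]
  simp only [smul_eq_mul]
  ring

theorem dotProduct_mulVec_single_add_single (B : Matrix ι ι ℂ) (i j : ι) (y : ℂ) :
    star (Pi.single i 1 + Pi.single j y) ⬝ᵥ B *ᵥ (Pi.single i 1 + Pi.single j y) =
      B i i + y * B i j + star y * B j i + star y * y * B j j := by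
  have : star (Pi.single i 1 + Pi.single j y : ι → ℂ) = Pi.single i 1 + Pi.single j (star y) := by
    ext k
    simp only [Pi.star_apply, Pi.add_apply, Pi.single_apply, star_add]
    split_ifs <;> simp
  rw [this]
  simp [mulVec_add, add_dotProduct, dotProduct_add]
  ring

theorem apply_eq_zero_of_trace_conj_nonneg {A : Matrix ι ι ℂ} (hA : A.IsHermitian) {d : ι → ℝ}
    (hpos : ∀ V ∈ unitaryGroup ι ℂ,
      0 ≤ (A * (V * diagonal (fun p => (d p : ℂ)) * Vᴴ)).trace)
    (hzero : (A * diagonal (fun p => (d p : ℂ))).trace = 0) {i j : ι} (hij : i ≠ j)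
    (hd : d i ≠ d j) : A i j = 0 := by
  have hji : A j i = star (A i j) := (congrFun (congrFun hA j) i).symm
  have hii : A i i = ((A i i).re : ℂ) := (Complex.conj_eq_iff_re.1 (congrFun (congrFun hA i) i)).symm
  have hjj : A j j = ((A j j).re : ℂ) := (Complex.conj_eq_iff_re.1 (congrFun (congrFun hA j) j)).symm
  generalize (A i i).re = a at hii
  generalize (A j j).re = b at hjj
  obtain ⟨z, hz⟩ : ∃ z, A i j = z := ⟨_, rfl⟩
  rw [hz] at hji ⊢
  set m := Complex.normSq z with hm
  have hzz : z * star z = (m : ℂ) := Complex.mul_conj z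
  have key : ∀ τ : ℝ, 0 ≤ (d i - d j) * m * τ * (1 - τ ^ 2 * m - τ * (a - b)) := by
    intro τ
    set y : ℂ := τ * star z with hy
    have hsy : star y = τ * z := by simp [hy]
    set u : ι → ℂ := Pi.single i 1 + Pi.single j y with hu
    have hm0 : 0 ≤ m := Complex.normSq_nonneg z
    set n : ℝ := 1 + τ ^ 2 * m with hn
    have hn0 : 0 < n := by positivity
    have huu : star u ⬝ᵥ u = (n : ℂ) := by
      have h := dotProduct_mulVec_single_add_single (1 : Matrix ι ι ℂ) i j y
      rw [one_mulVec, ← hu] at h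
      rw [h, hsy, hy, hn]
      simp only [one_apply_eq, one_apply_ne hij, one_apply_ne hij.symm]
      push_cast
      linear_combination (τ : ℂ) ^ 2 * hzz
    have hV := one_sub_smul_vecMulVec_mem_unitaryGroup (u := u) (c := 2 / n) (by
      rw [huu]; push_cast; field_simp)
    have h := hpos _ hV
    have hVs : (1 - ((2 / n : ℝ) : ℂ) • vecMulVec u (star u))ᴴ =
        1 - ((2 / n : ℝ) : ℂ) • vecMulVec u (star u) := by
      rw [conjTranspose_sub, conjTranspose_one, conjTranspose_smul, conjTranspose_vecMulVec,
        star_star, Complex.star_def, Complex.conj_ofReal]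
    rw [hVs, trace_mul_householder, hzero, hu] at h
    simp only [dotProduct_mulVec_single_add_single, hsy] at h
    simp only [diagonal_mul, mul_diagonal, diagonal_apply_eq, diagonal_apply_ne _ hij,
      diagonal_apply_ne _ hij.symm, hy, hz, hji, hii, hjj] at h
    have hval : (0 : ℂ) - ((2 / n : ℝ) : ℂ) * (d i * a + τ * star z * (d i * z) +
        τ * z * (d j * star z) + τ * z * (τ * star z) * (d j * b) +
        (a * d i + τ * star z * (z * d j) + τ * z * (star z * d i) +
          τ * z * (τ * star z) * (b * d j))) +
        ((2 / n : ℝ) : ℂ) ^ 2 * ((d i + τ * star z * 0 + τ * z * 0 + τ * z * (τ * star z) * d j) *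
          (a + τ * star z * z + τ * z * star z + τ * z * (τ * star z) * b)) =
        ((4 / n ^ 2 * ((d i - d j) * m * τ * (1 - τ ^ 2 * m - τ * (a - b))) : ℝ) : ℂ) := by
      have : (0 : ℂ) - ((2 / n : ℝ) : ℂ) * (d i * a + τ * star z * (d i * z) +
        τ * z * (d j * star z) + τ * z * (τ * star z) * (d j * b) +
        (a * d i + τ * star z * (z * d j) + τ * z * (star z * d i) +
          τ * z * (τ * star z) * (b * d j))) +
        ((2 / n : ℝ) : ℂ) ^ 2 * ((d i + τ * star z * 0 + τ * z * 0 + τ * z * (τ * star z) * d j) *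
          (a + τ * star z * z + τ * z * star z + τ * z * (τ * star z) * b)) =
          - ((2 / n : ℝ) : ℂ) * (2 * d i * a + 2 * τ * (z * star z) * (d i + d j) +
            2 * τ ^ 2 * (z * star z) * (d j * b)) + ((2 / n : ℝ) : ℂ) ^ 2 *
            ((d i + τ ^ 2 * (z * star z) * d j) *
              (a + 2 * τ * (z * star z) + τ ^ 2 * (z * star z) * b)) := by ring
      rw [this, hzz]
      norm_cast
      field_simp
      rw [hn]
      ring
    rw [hval, ← Complex.ofReal_zero, Complex.real_le_real] at h
    exact nonneg_of_mul_nonneg_right h (by positivity)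
  have hm0 : 0 ≤ m := Complex.normSq_nonneg z
  by_contra hz0
  have hmpos : 0 < m := Complex.normSq_pos.2 hz0
  set K : ℝ := 2 + m + |a - b| with hK
  have hKpos : 0 < K := by positivity
  have hfac : ∀ τ : ℝ, |τ| = 1 / K → 0 < 1 - τ ^ 2 * m - τ * (a - b) := by
    intro τ hτ
    have h1 : τ * (a - b) ≤ 1 / K * |a - b| := by
      rw [← hτ, ← abs_mul]; exact le_abs_self _
    have h2 : τ ^ 2 * m ≤ 1 / K * m := by
      refine mul_le_mul_of_nonneg_right ?_ hm0
      rw [← sq_abs, hτ, sq]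
      refine mul_le_of_le_one_left (by positivity) ?_
      rw [div_le_one hKpos]
      have := abs_nonneg (a - b)
      linarith
    have h3 : 1 / K * m + 1 / K * |a - b| + 1 / K * 2 = 1 := by
      rw [← mul_add, ← mul_add, one_div, inv_mul_eq_one₀ hKpos.ne', hK]; ring
    have h4 : 0 < 1 / K := by positivity
    linarith
  have hτ : 0 < 1 / K := by positivity
  have hp := nonneg_of_mul_nonneg_left (key (1 / K)) (hfac _ (abs_of_pos hτ))
  have hq := nonneg_of_mul_nonneg_left (key (-(1 / K))) (hfac _ (by rw [abs_neg, abs_of_pos hτ]))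
  have hprod : (d i - d j) * m * (1 / K) = 0 := le_antisymm (by linarith) hp
  exact hd (by
    have := mul_eq_zero.1 hprod
    rcases this with h | h
    · rcases mul_eq_zero.1 h with h | h
      · linarith
      · exact absurd h hmpos.ne'
    · exact absurd h hτ.ne')

end Perturbation

/-- The spectrum with `4` at `(2, 2)`, `2` at `j`, `1` at `k`, `-2` at `i` and `0` elsewhere. -/
def rankTwoWeight (i j k p : QIdx) : ℝ :=
  if p = (2, 2) then 4 else if p = j then 2 else if p = k then 1 else if p = i then -2 else 0

/-- The spectrum with `16` at `(2, 2)`, `4` at `(2, 0)` and `(2, 1)`, and the six values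
`1, 1, 1, -1, -4, -4` elsewhere. -/
def rankThreeWeight (p : QIdx) : ℝ :=
  if p.1 = 2 then (if p.2 = 2 then 16 else 4) else if p.2 = 2 then -4
  else if p = (1, 0) then -1 else 1

theorem exists_perm_rankTwoWeight {i : QIdx} (hi : i.1 ≠ 2) :
    ∃ e : Equiv.Perm QIdx, ∀ p, rankTwoWeight i (2, 0) (2, 1) p = swapEig ![1, 0, 2] (e p) := by
  refine ⟨Equiv.swap (0, 0) (2, 1) * Equiv.swap (2, 0) (0, 2) * Equiv.swap (0, 2) i, ?_⟩
  obtain ⟨i, j⟩ := i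
  rintro ⟨k, l⟩
  fin_cases i <;> first | exact absurd rfl hi | skip
  all_goals fin_cases j <;> fin_cases k <;> fin_cases l <;>
    simp [rankTwoWeight, swapEig, Equiv.swap_apply_def] <;> norm_num

theorem exists_perm_rankTwoWeight' :
    ∃ e : Equiv.Perm QIdx,
      ∀ p, rankTwoWeight (0, 2) (2, 1) (2, 0) p = swapEig ![1, 0, 2] (e p) := by
  refine ⟨Equiv.swap (0, 0) (2, 1) * Equiv.swap (2, 0) (0, 2) * Equiv.swap (2, 0) (2, 1), ?_⟩
  rintro ⟨k, l⟩
  fin_cases k <;> fin_cases l <;> simp [rankTwoWeight, swapEig, Equiv.swap_apply_def]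
  norm_num

theorem exists_perm_rankThreeWeight :
    ∃ e : Equiv.Perm QIdx, ∀ p, rankThreeWeight p = swapEig ![1, 1, 4] (e p) := by
  refine ⟨Equiv.swap (2, 0) (0, 2) * Equiv.swap (2, 1) (1, 2), ?_⟩
  rintro ⟨k, l⟩
  fin_cases k <;> fin_cases l <;> simp [rankThreeWeight, swapEig, Equiv.swap_apply_def]
  norm_num

theorem trace_mul_diagonal_eq_zero {A B : Matrix QIdx QIdx ℂ} (hA : A ∈ AP33) (hB : B ∈ AP33)
    (hAB : (diagonal fun p => ((spec p / 57 : ℝ) : ℂ)) ∈ openSegment ℝ A B) {d : QIdx → ℝ}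
    {s : Fin 3 → ℝ} {e : Equiv.Perm QIdx} (hd : ∀ p, d p = swapEig s (e p))
    (hspec : ∑ p, spec p * d p = 0) :
    (A * diagonal (fun p => (d p : ℂ))).trace = 0 := by
  have hA0 := trace_conj_nonneg_of_mem_AP33 hA hd (one_mem _)
  have hB0 := trace_conj_nonneg_of_mem_AP33 hB hd (one_mem _)
  simp only [conjTranspose_one, Matrix.one_mul, Matrix.mul_one] at hA0 hB0
  obtain ⟨a, b, ha, hb, -, h⟩ := hAB
  have htr : a • (A * diagonal (fun p => (d p : ℂ))).trace +
      b • (B * diagonal (fun p => (d p : ℂ))).trace = 0 := by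
    rw [← trace_smul, ← trace_smul, ← trace_add, ← smul_mul_assoc, ← smul_mul_assoc,
      ← Matrix.add_mul, h, diagonal_mul_diagonal, trace_diagonal]
    simp only [← Complex.ofReal_mul, ← Complex.ofReal_sum]
    rw [← Complex.ofReal_zero]
    congr 1
    calc _ = (∑ p, spec p * d p) / 57 := by
          rw [Finset.sum_div]; exact Finset.sum_congr rfl fun p _ => by ring
      _ = 0 := by rw [hspec, zero_div]
  have h1 := smul_nonneg hb.le hB0
  have h2 := smul_nonneg ha.le hA0
  have h3 := (add_eq_zero_iff_of_nonneg h2 h1).1 htr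
  exact (smul_eq_zero.1 h3.1).resolve_left ha.ne'

theorem sum_spec_mul_rankTwoWeight {i : QIdx} (hi : i.1 ≠ 2) :
    ∑ p, spec p * rankTwoWeight i (2, 0) (2, 1) p = 0 := by
  obtain ⟨i, j⟩ := i
  fin_cases i <;> first | exact absurd rfl hi | skip
  all_goals
    fin_cases j <;> simp [Fintype.sum_prod_type, Fin.sum_univ_three, rankTwoWeight, spec] <;>
    norm_num

theorem eq_diagonal_of_mem_openSegment {A B : Matrix QIdx QIdx ℂ} (hA : A ∈ AP33) (hB : B ∈ AP33)
    (hAB : (diagonal fun p => ((spec p / 57 : ℝ) : ℂ)) ∈ openSegment ℝ A B) :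
    A = diagonal fun p => ((spec p / 57 : ℝ) : ℂ) := by
  have hherm := hA.1.isHermitian
  have htwo : ∀ i : QIdx, i.1 ≠ 2 →
      (A * diagonal (fun p => (rankTwoWeight i (2, 0) (2, 1) p : ℂ))).trace = 0 := fun i hi =>
    trace_mul_diagonal_eq_zero hA hB hAB (exists_perm_rankTwoWeight hi).choose_spec
      (sum_spec_mul_rankTwoWeight hi)
  have htwo' : (A * diagonal (fun p => (rankTwoWeight (0, 2) (2, 1) (2, 0) p : ℂ))).trace = 0 := by
    refine trace_mul_diagonal_eq_zero hA hB hAB exists_perm_rankTwoWeight'.choose_spec ?_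
    simp [Fintype.sum_prod_type, Fin.sum_univ_three, rankTwoWeight, spec]
    norm_num
  have hthree : (A * diagonal (fun p => (rankThreeWeight p : ℂ))).trace = 0 := by
    refine trace_mul_diagonal_eq_zero hA hB hAB exists_perm_rankThreeWeight.choose_spec ?_
    simp [Fintype.sum_prod_type, Fin.sum_univ_three, rankThreeWeight, spec]
    norm_num
  have hoff : ∀ i j k : QIdx, i.1 ≠ 2 → j ≠ k →
      rankTwoWeight i (2, 0) (2, 1) j ≠ rankTwoWeight i (2, 0) (2, 1) k → A j k = 0 :=
    fun i j k hi hjk hd => apply_eq_zero_of_trace_conj_nonneg hherm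
      (fun V hV => trace_conj_nonneg_of_mem_AP33 hA (exists_perm_rankTwoWeight hi).choose_spec hV)
      (htwo i hi) hjk hd
  have hdiag : ∀ j k : QIdx, j ≠ k → A j k = 0 := by
    have hblock : ∀ j k : QIdx, j.1 ≠ 2 → j ≠ k → A j k = 0 := by
      intro j k hj hjk
      refine hoff j j k hj hjk ?_
      have h1 : rankTwoWeight j (2, 0) (2, 1) j = -2 := by
        have h22 : j ≠ (2, 2) := fun h => hj (by rw [h])
        have h20 : j ≠ (2, 0) := fun h => hj (by rw [h])
        have h21 : j ≠ (2, 1) := fun h => hj (by rw [h])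
        simp [rankTwoWeight, h22, h20, h21]
      rw [h1]
      unfold rankTwoWeight
      rw [if_neg hjk.symm]
      split_ifs <;> norm_num
    intro j k hjk
    by_cases hj : j.1 = 2
    · by_cases hk : k.1 = 2
      · refine hoff (0, 0) j k (by decide) hjk ?_
        obtain ⟨j1, j2⟩ := j
        obtain ⟨k1, k2⟩ := k
        obtain rfl : j1 = 2 := hj
        obtain rfl : k1 = 2 := hk
        fin_cases j2 <;> fin_cases k2 <;> first | exact absurd rfl hjk | skip
        all_goals simp [rankTwoWeight]
      · rw [← hherm.apply, hblock k j hk hjk.symm, star_zero]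
    · exact hblock j k hj hjk
  have htrace := hA.2.1
  have h00 := htwo (0, 0) (by decide)
  have h01 := htwo (0, 1) (by decide)
  have h02 := htwo (0, 2) (by decide)
  have h10 := htwo (1, 0) (by decide)
  have h11 := htwo (1, 1) (by decide)
  have h12 := htwo (1, 2) (by decide)
  simp only [trace, diag, mul_diagonal, Fintype.sum_prod_type, Fin.sum_univ_three]
    at htrace h00 h01 h02 h10 h11 h12 htwo' hthree
  simp [rankTwoWeight] at h00 h01 h02 h10 h11 h12 htwo'
  simp [rankThreeWeight] at hthree
  ext p q
  by_cases hpq : p = q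
  · subst hpq
    rw [diagonal_apply_eq]
    obtain ⟨k, l⟩ := p
    push_cast
    fin_cases k <;> fin_cases l <;> simp [spec] <;> grind
  · rw [hdiag p q hpq, diagonal_apply_ne _ hpq]

/-- the state (1/57)·diag(8, 8, 8, 8, 8, 8, 4, 4, 1) is an extreme point
of AP_{3,3}. -/
theorem nu621_extreme :
    ((1 : ℝ) / 57) • diag9 ![8, 8, 8, 8, 8, 8, 4, 4, 1]
      ∈ Set.extremePoints ℝ AP33 := by
  refine ⟨smul_diag9_mem_AP33, fun A hA B hB hAB => ?_⟩
  rw [smul_diag9_eq_diagonal] at hAB ⊢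
  exact eq_diagonal_of_mem_openSegment hA hB hAB
end
end

section
/- For every real c with 0 < c < (23−14√2)/137, set a = (4 − 3c + √(8c − 7c²))/32 and b = (4 − 11c − 7√(8c − 7c²))/32. Then the 9×9 diagonal matrix diag(a, a, a, a, a, a, a, b, c) is an extreme point of AP_{3,3}. -/
open Matrix ComplexOrder

noncomputable section

/-- Singular value decomposition of a complex square matrix. -/
theorem Matrix.exists_svd {n : Type*} [Fintype n] [DecidableEq n] (M : Matrix n n ℂ) :
    ∃ A ∈ unitaryGroup n ℂ, ∃ B ∈ unitaryGroup n ℂ, ∃ s : n → ℝ,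
      (∀ i, 0 ≤ s i) ∧ M = A * diagonal (fun i => (s i : ℂ)) * B := by
  have hP : (Mᴴ * M).PosSemidef := posSemidef_conjTranspose_mul_self M
  have hH := hP.isHermitian
  set W : Matrix n n ℂ := hH.eigenvectorUnitary.1
  have hWu : W ∈ unitaryGroup n ℂ := hH.eigenvectorUnitary.2
  set s : n → ℝ := fun i => √(hH.eigenvalues i)
  have hss : ∀ i, s i * s i = hH.eigenvalues i := fun i =>
    Real.mul_self_sqrt (hP.eigenvalues_nonneg i)
  set N := M * W with hN
  have hNN : Nᴴ * N = diagonal (fun i => (s i : ℂ) * s i) := by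
    have h := hH.spectral_theorem
    rw [Unitary.conjStarAlgAut_apply] at h
    have h2 : Wᴴ * W = 1 := (mem_unitaryGroup_iff').1 hWu
    calc Nᴴ * N = Wᴴ * (Mᴴ * M) * W := by
          simp only [hN, conjTranspose_mul, Matrix.mul_assoc]
      _ = Wᴴ * (W * diagonal (RCLike.ofReal ∘ hH.eigenvalues) * Wᴴ) * W := by
          conv_lhs => rw [h]
          rfl
      _ = (Wᴴ * W) * diagonal (RCLike.ofReal ∘ hH.eigenvalues) * (Wᴴ * W) := by
          simp only [Matrix.mul_assoc]
      _ = _ := by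
          rw [h2, Matrix.one_mul, Matrix.mul_one]
          congr 1; ext i
          simp [← hss]
  have hcol : ∀ i j, ∑ k, star (N k i) * N k j = if i = j then (s i : ℂ) * s i else 0 := by
    intro i j
    have := congrFun (congrFun hNN i) j
    simpa [mul_apply, diagonal_apply] using this
  let v : n → EuclideanSpace ℂ n := fun j => WithLp.toLp 2 fun i => (s j : ℂ)⁻¹ * N i j
  have hv : Orthonormal ℂ (Set.domRestrict {i | s i ≠ 0} v) := by
    rw [orthonormal_iff_ite]
    rintro ⟨i, hi⟩ ⟨j, hj⟩
    have hi' : (s i : ℂ) ≠ 0 := by exact_mod_cast hi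
    have hin : inner ℂ (v i) (v j) = (s i : ℂ)⁻¹ * (s j : ℂ)⁻¹ * ∑ k, star (N k i) * N k j := by
      simp only [v, PiLp.inner_apply, RCLike.inner_apply, Finset.mul_sum]
      refine Finset.sum_congr rfl fun k _ => ?_
      simp
      ring
    change inner ℂ (v i) (v j) = _
    simp only [hin, hcol, Subtype.mk.injEq]
    split_ifs with h
    · subst h; field_simp
    · simp
  obtain ⟨b, hb⟩ := hv.exists_orthonormalBasis_extension_of_card_eq (by simp)
  let A : Matrix n n ℂ := of fun i j => b j i
  have hA : A ∈ unitaryGroup n ℂ := by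
    rw [mem_unitaryGroup_iff']
    ext i j
    have := orthonormal_iff_ite.1 b.orthonormal i j
    simp only [PiLp.inner_apply, RCLike.inner_apply] at this
    simp only [star_eq_conjTranspose, mul_apply, conjTranspose_apply, A, of_apply, one_apply,
      ← this]
    exact Finset.sum_congr rfl fun k _ => mul_comm _ _
  have hNA : N = A * diagonal (fun i => (s i : ℂ)) := by
    ext i j
    simp only [mul_diagonal, A, of_apply]
    by_cases hj : s j = 0
    · have h0 := hcol j j
      have h1 : ∑ k, ‖N k j‖ ^ 2 = 0 := by
        have : ((∑ k, ‖N k j‖ ^ 2 : ℝ) : ℂ) = 0 := by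
          simp only [hj, if_true, Complex.ofReal_zero, mul_zero] at h0
          rw [← h0]
          push_cast
          exact Finset.sum_congr rfl fun k _ => by
            rw [← Complex.conj_mul']; rfl
        exact_mod_cast this
      have h2 := (Finset.sum_eq_zero_iff_of_nonneg (fun k _ => by positivity)).1 h1 i
        (Finset.mem_univ i)
      simp only [hj, Complex.ofReal_zero, mul_zero]
      simpa using h2
    · have hj' : (s j : ℂ) ≠ 0 := by exact_mod_cast hj
      rw [hb j hj]
      simp only [v]
      field_simp
  refine ⟨A, hA, Wᴴ, ?_, s, fun i => Real.sqrt_nonneg _, ?_⟩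
  · exact Unitary.star_mem hWu
  · have h3 : W * Wᴴ = 1 := (mem_unitaryGroup_iff).1 hWu
    rw [← hNA, hN, Matrix.mul_assoc, h3, Matrix.mul_one]

/-- The `p`-th column of `U`, reshaped as a `3 × 3` matrix. -/
def colMatrix (U : Matrix QIdx QIdx ℂ) (p : QIdx) : Matrix (Fin 3) (Fin 3) ℂ :=
  of fun i j => U (i, j) p

/-- The value at the vector `Ψ` of the quadratic form of the partial transpose of the rank-one
matrix `V Vᴴ`, where vectors are reshaped as `3 × 3` matrices. -/
def ptForm (Ψ V : Matrix (Fin 3) (Fin 3) ℂ) : ℂ :=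
  (Ψᴴ * V * Ψᵀ * Vᴴᵀ).trace

theorem dotProduct_PT_mulVec_s19 (U : Matrix QIdx QIdx ℂ) (d ψ : QIdx → ℂ) :
    star ψ ⬝ᵥ (PT (U * diagonal d * Uᴴ) *ᵥ ψ) =
      ∑ p, d p * ptForm (of fun i j => ψ (i, j)) (colMatrix U p) := by
  have hPT : ∀ p q, PT (U * diagonal d * Uᴴ) p q =
      ∑ r, d r * (U (p.1, q.2) r * star (U (q.1, p.2) r)) := by
    intro p q
    simp only [PT, mul_apply, conjTranspose_apply]
    simp only [diagonal_apply, mul_ite, mul_zero, Finset.sum_ite_eq', Finset.mem_univ,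
      if_true]
    exact Finset.sum_congr rfl fun r _ => by ring
  simp only [dotProduct, mulVec, hPT, Finset.sum_mul, Finset.mul_sum]
  rw [Finset.sum_congr rfl fun _ _ => Finset.sum_comm, Finset.sum_comm]
  refine Finset.sum_congr rfl fun r _ => ?_
  simp only [ptForm, colMatrix, trace, diag_apply, mul_apply, Fintype.sum_prod_type,
    Fin.sum_univ_three, of_apply, conjTranspose_apply, transpose_apply, Pi.star_apply]
  ring

theorem PT_one : PT 1 = 1 := by
  ext ⟨i, j⟩ ⟨k, l⟩
  simp only [PT, one_apply, Prod.mk.injEq]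
  exact if_congr (by tauto) rfl rfl

theorem ptForm_mul (A B D V : Matrix (Fin 3) (Fin 3) ℂ) :
    ptForm (A * D * B) V = ptForm D (Aᴴ * V * Bᵀ) := by
  have hV : (Aᴴ * V * Bᵀ)ᴴᵀ = Aᵀ * Vᴴᵀ * Bᴴ := by
    simp only [conjTranspose_mul, transpose_mul, conjTranspose_conjTranspose, Matrix.mul_assoc]
    rfl
  rw [ptForm, ptForm, hV, conjTranspose_mul (A * D) B, Matrix.mul_assoc Bᴴ,
    Matrix.mul_assoc Bᴴ, Matrix.mul_assoc Bᴴ, trace_mul_comm]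
  simp only [conjTranspose_mul, transpose_mul, Matrix.mul_assoc]

theorem ptForm_diagonal_re_le (s : Fin 3 → ℝ) (hs : ∀ i, 0 ≤ s i)
    (V : Matrix (Fin 3) (Fin 3) ℂ) :
    (ptForm (diagonal fun i => (s i : ℂ)) V).re ≤ ∑ i, ∑ j, s i * s j * ‖V i j‖ ^ 2 := by
  have key : ∀ i j, (V i j * star (V j i)).re ≤ (‖V i j‖ ^ 2 + ‖V j i‖ ^ 2) / 2 := by
    intro i j
    have h := Complex.re_le_norm (V i j * star (V j i))
    rw [norm_mul, norm_star] at h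
    nlinarith [sq_nonneg (‖V i j‖ - ‖V j i‖)]
  have hE : (ptForm (diagonal fun i => (s i : ℂ)) V).re =
      ∑ i, ∑ j, s i * s j * (V i j * star (V j i)).re := by
    have : ptForm (diagonal fun i => (s i : ℂ)) V =
        ∑ i, ∑ j, ((s i * s j : ℝ) : ℂ) * (V i j * star (V j i)) := by
      simp only [ptForm, trace, diag_apply, mul_apply (N := Vᴴᵀ), diagonal_transpose,
        diagonal_conjTranspose, mul_diagonal, diagonal_mul, transpose_apply, conjTranspose_apply]
      refine Finset.sum_congr rfl fun i _ => Finset.sum_congr rfl fun j _ => ?_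
      simp
      ring
    rw [this]
    simp only [Complex.re_sum, Complex.re_ofReal_mul]
  calc _ ≤ ∑ i, ∑ j, s i * s j * ((‖V i j‖ ^ 2 + ‖V j i‖ ^ 2) / 2) := by
        rw [hE]
        exact Finset.sum_le_sum fun i _ => Finset.sum_le_sum fun j _ =>
          mul_le_mul_of_nonneg_left (key i j) (mul_nonneg (hs i) (hs j))
    _ = _ := by
        simp only [Fin.sum_univ_three]
        ring

theorem sum_mul_mul_le (s : Fin 3 → ℝ) (hs : ∀ i, 0 ≤ s i) {t : ℝ} (ht : 0 ≤ t)
    (ht1 : t ^ 2 + 2 * t ≤ 1) (x y : QIdx → ℝ) (hx : ∀ p, 0 ≤ x p) (hy : ∀ p, 0 ≤ y p)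
    (hx1 : ∑ p, x p = 1) (hy1 : ∑ p, y p = 1) (hxy : ∀ p, x p + y p ≤ 1) :
    2 * t * ∑ i, ∑ j, s i * s j * x (i, j) + (1 - t ^ 2) * ∑ i, ∑ j, s i * s j * y (i, j) ≤
      ∑ i, s i ^ 2 := by
  obtain ⟨m, -, hm⟩ := Finset.exists_max_image Finset.univ s Finset.univ_nonempty
  obtain ⟨l, hl, hlm⟩ := Finset.exists_max_image (Finset.univ.erase m) s
    (by rw [← Finset.card_pos]; simp)
  have hne : l ≠ m := (Finset.mem_erase.1 hl).1
  have hm' : ∀ i, s i ≤ s m := fun i => hm i (Finset.mem_univ i)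
  have hl' : ∀ i, i ≠ m → s i ≤ s l := fun i hi =>
    hlm i (Finset.mem_erase.2 ⟨hi, Finset.mem_univ i⟩)
  have hcoef : ∀ p : QIdx, s p.1 * s p.2 ≤
      s m * s l + if p = (m, m) then s m ^ 2 - s m * s l else 0 := by
    rintro ⟨i, j⟩
    by_cases hi : i = m
    · subst hi
      by_cases hj : j = i
      · subst hj
        simp only [if_true]
        linarith
      · simp only [Prod.mk.injEq, hj, and_false, if_false, add_zero]
        exact mul_le_mul_of_nonneg_left (hl' j hj) (hs i)
    · simp only [Prod.mk.injEq, hi, false_and, if_false, add_zero]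
      rw [mul_comm (s m)]
      exact mul_le_mul (hl' i hi) (hm' j) (hs j) (hs l)
  have hbound : ∀ z : QIdx → ℝ, (∀ p, 0 ≤ z p) → ∑ p, z p = 1 →
      ∑ i, ∑ j, s i * s j * z (i, j) ≤ s m * s l + (s m ^ 2 - s m * s l) * z (m, m) := by
    intro z hz hz1
    rw [← Fintype.sum_prod_type' (fun i j => s i * s j * z (i, j))]
    calc _ ≤ ∑ p : QIdx, (s m * s l + if p = (m, m) then s m ^ 2 - s m * s l else 0) * z p :=
          Finset.sum_le_sum fun p _ => mul_le_mul_of_nonneg_right (hcoef p) (hz p)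
      _ = _ := by
          simp only [add_mul, Finset.sum_add_distrib, ← Finset.mul_sum, hz1, ite_mul, zero_mul,
            Finset.sum_ite_eq', Finset.mem_univ, if_true, mul_one]
  have hX := mul_le_mul_of_nonneg_left (hbound x hx hx1) (show 0 ≤ 2 * t by linarith)
  have hY := mul_le_mul_of_nonneg_left (hbound y hy hy1) (show 0 ≤ 1 - t ^ 2 by linarith)
  have hdiff : 0 ≤ s m ^ 2 - s m * s l := by nlinarith [hm' l, hs m]
  have hw : 2 * t * x (m, m) + (1 - t ^ 2) * y (m, m) ≤ 1 - t ^ 2 := by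
    nlinarith [hx (m, m), hy (m, m), hxy (m, m)]
  have hw' := mul_le_mul_of_nonneg_left hw hdiff
  have hsum : s m ^ 2 + s l ^ 2 ≤ ∑ i, s i ^ 2 := by
    rw [← Finset.sum_pair hne.symm (f := fun i => s i ^ 2)]
    exact Finset.sum_le_sum_of_subset_of_nonneg (Finset.subset_univ _) fun i _ _ => sq_nonneg _
  nlinarith [sq_nonneg (t * s m - s l)]

theorem sum_row_norm_sq {U : Matrix QIdx QIdx ℂ} (hU : U ∈ unitaryGroup QIdx ℂ) (p : QIdx) :
    ∑ q, ‖U p q‖ ^ 2 = 1 := by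
  have h := congrFun (congrFun (mem_unitaryGroup_iff.1 hU) p) p
  simp only [star_eq_conjTranspose, mul_apply, conjTranspose_apply, one_apply_eq] at h
  have h2 : ((∑ q, ‖U p q‖ ^ 2 : ℝ) : ℂ) = 1 := by
    rw [← h]
    push_cast
    exact Finset.sum_congr rfl fun k _ => (Complex.mul_conj' _).symm
  exact_mod_cast h2

theorem sum_col_norm_sq {U : Matrix QIdx QIdx ℂ} (hU : U ∈ unitaryGroup QIdx ℂ) (p : QIdx) :
    ∑ q, ‖U q p‖ ^ 2 = 1 := by
  simpa [conjTranspose_apply] using sum_row_norm_sq (Unitary.star_mem hU) p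

theorem ptForm_re_weighted_le {U : Matrix QIdx QIdx ℂ} (hU : U ∈ unitaryGroup QIdx ℂ) {t : ℝ}
    (ht : 0 ≤ t) (ht1 : t ^ 2 + 2 * t ≤ 1) (Ψ : Matrix (Fin 3) (Fin 3) ℂ) {p q : QIdx}
    (hpq : p ≠ q) :
    2 * t * (ptForm Ψ (colMatrix U p)).re + (1 - t ^ 2) * (ptForm Ψ (colMatrix U q)).re ≤
      (Ψᴴ * Ψ).trace.re := by
  obtain ⟨A, hA, B, hB, s, hs, rfl⟩ := exists_svd Ψ
  have hA' : Aᴴ * A = 1 := mem_unitaryGroup_iff'.1 hA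
  have hB' : B * Bᴴ = 1 := mem_unitaryGroup_iff.1 hB
  have hW : kroneckerMap (· * ·) Aᴴ B * U ∈ unitaryGroup QIdx ℂ :=
    mul_mem (kronecker_mem_unitary (Unitary.star_mem hA) hB) hU
  set W := kroneckerMap (· * ·) Aᴴ B * U with hWdef
  have hcol : ∀ r, Aᴴ * colMatrix U r * Bᵀ = colMatrix W r := by
    intro r
    ext i j
    simp only [hWdef, colMatrix, mul_apply, of_apply, kroneckerMap_apply, transpose_apply,
      Fintype.sum_prod_type, Finset.sum_mul]
    rw [Finset.sum_comm]
    exact Finset.sum_congr rfl fun _ _ => Finset.sum_congr rfl fun _ _ => by ring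
  have htr : ((A * diagonal (fun i => (s i : ℂ)) * B)ᴴ *
      (A * diagonal (fun i => (s i : ℂ)) * B)).trace.re = ∑ i, s i ^ 2 := by
    have : (A * diagonal (fun i => (s i : ℂ)) * B)ᴴ * (A * diagonal (fun i => (s i : ℂ)) * B) =
        Bᴴ * ((diagonal fun i => (s i : ℂ))ᴴ * (Aᴴ * A) * diagonal (fun i => (s i : ℂ)) * B) := by
      simp only [conjTranspose_mul, Matrix.mul_assoc]
    rw [this, trace_mul_comm, Matrix.mul_assoc _ B, hB', hA']
    simp [trace, diagonal_conjTranspose, ← Complex.ofReal_mul, pow_two]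
  simp only [ptForm_mul, hcol, htr]
  have hrow : ∀ r, ‖W r p‖ ^ 2 + ‖W r q‖ ^ 2 ≤ 1 := fun r => by
    rw [← sum_row_norm_sq hW r, ← Finset.sum_pair hpq (f := fun k => ‖W r k‖ ^ 2)]
    exact Finset.sum_le_sum_of_subset_of_nonneg (Finset.subset_univ _) fun i _ _ => sq_nonneg _
  have hmain := sum_mul_mul_le s hs ht ht1 (fun r => ‖W r p‖ ^ 2) (fun r => ‖W r q‖ ^ 2)
    (fun _ => sq_nonneg _) (fun _ => sq_nonneg _) (sum_col_norm_sq hW p) (sum_col_norm_sq hW q)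
    hrow
  have hp := mul_le_mul_of_nonneg_left (ptForm_diagonal_re_le s hs (colMatrix W p))
    (show 0 ≤ 2 * t by linarith)
  have hq := mul_le_mul_of_nonneg_left (ptForm_diagonal_re_le s hs (colMatrix W q))
    (show 0 ≤ 1 - t ^ 2 by linarith)
  exact (add_le_add hp hq).trans hmain

/-- The diagonal of the state with eigenvalues `a` (seven times), `a * (1 - 2 * t)` and
`a * t ^ 2`. -/
def stateDiag (a t : ℝ) (p : QIdx) : ℂ :=
  if p = (2, 2) then a * t ^ 2 else if p = (2, 1) then a * (1 - 2 * t) else a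

theorem sum_stateDiag_mul (a t : ℝ) (F : QIdx → ℂ) :
    ∑ p, stateDiag a t p * F p =
      a * (∑ p, F p - 2 * t * F (2, 1) - (1 - t ^ 2) * F (2, 2)) := by
  simp [stateDiag, Fintype.sum_prod_type, Fin.sum_univ_three]
  ring

theorem isHermitian_PT {M : Matrix QIdx QIdx ℂ} (hM : M.IsHermitian) : (PT M).IsHermitian := by
  ext p q
  simpa [PT] using hM.apply (p.1, q.2) (q.1, p.2)

theorem stateDiag_nonneg {a t : ℝ} (ha : 0 ≤ a) (ht1 : t ^ 2 + 2 * t ≤ 1)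
    (p : QIdx) : 0 ≤ stateDiag a t p := by
  have h1 : 0 ≤ a * t ^ 2 := by positivity
  have h2 : 0 ≤ a * (1 - 2 * t) := mul_nonneg ha (by nlinarith)
  unfold stateDiag
  split_ifs
  · exact_mod_cast h1
  · exact_mod_cast h2
  · exact_mod_cast ha

theorem trace_diagonal_stateDiag (a t : ℝ) :
    (diagonal (stateDiag a t)).trace = a * (8 - 2 * t + t ^ 2) := by
  have h := sum_stateDiag_mul a t 1
  simp only [Pi.one_apply, mul_one] at h
  rw [trace_diagonal, h, Finset.sum_const, Finset.card_univ]
  norm_num [Fintype.card_prod]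
  ring_nf
  simp

theorem posSemidef_PT_conj {a t : ℝ} (ha : 0 ≤ a) (ht : 0 ≤ t) (ht1 : t ^ 2 + 2 * t ≤ 1)
    {U : Matrix QIdx QIdx ℂ} (hU : U ∈ unitaryGroup QIdx ℂ) :
    (PT (U * diagonal (stateDiag a t) * Uᴴ)).PosSemidef := by
  have hd : (diagonal (stateDiag a t)).PosSemidef :=
    posSemidef_diagonal_iff.2 (stateDiag_nonneg ha ht1)
  have hH : (PT (U * diagonal (stateDiag a t) * Uᴴ)).IsHermitian :=
    isHermitian_PT (hd.mul_mul_conjTranspose_same U).isHermitian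
  refine .of_dotProduct_mulVec_nonneg hH fun ψ => ?_
  have him : (star ψ ⬝ᵥ (PT (U * diagonal (stateDiag a t) * Uᴴ) *ᵥ ψ)).im = 0 :=
    hH.im_star_dotProduct_mulVec_self ψ
  refine Complex.nonneg_iff.2 ⟨?_, him.symm⟩
  have hone : ∑ p, ptForm (of fun i j => ψ (i, j)) (colMatrix U p) =
      ((of fun i j => ψ (i, j))ᴴ * of fun i j => ψ (i, j)).trace := by
    have h := dotProduct_PT_mulVec_s19 U (fun _ => 1) ψ
    simp only [diagonal_one, Matrix.mul_one, one_mul] at h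
    rw [show U * Uᴴ = 1 from mem_unitaryGroup_iff.1 hU, PT_one, one_mulVec] at h
    rw [← h]
    simp only [dotProduct, Fintype.sum_prod_type, trace, diag_apply, mul_apply,
      conjTranspose_apply, of_apply, Pi.star_apply]
    exact Finset.sum_comm
  have h := ptForm_re_weighted_le hU ht ht1 (of fun i j => ψ (i, j))
    (show ((2, 1) : QIdx) ≠ (2, 2) by decide)
  rw [dotProduct_PT_mulVec_s19, sum_stateDiag_mul, hone, Complex.re_ofReal_mul]
  refine mul_nonneg ha ?_
  have e1 : ∀ z : ℂ, ((2 * t : ℂ) * z).re = 2 * t * z.re := fun z => by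
    rw [← Complex.re_ofReal_mul]; push_cast; rfl
  have e2 : ∀ z : ℂ, ((1 - t ^ 2 : ℂ) * z).re = (1 - t ^ 2) * z.re := fun z => by
    rw [← Complex.re_ofReal_mul]; push_cast; rfl
  rw [Complex.sub_re, Complex.sub_re, e1, e2]
  linarith

theorem diagonal_stateDiag_mem_AP33 {a t : ℝ} (ha : 0 ≤ a) (ht : 0 ≤ t)
    (ht1 : t ^ 2 + 2 * t ≤ 1) (htr : a * (8 - 2 * t + t ^ 2) = 1) :
    diagonal (stateDiag a t) ∈ AP33 := by
  refine ⟨posSemidef_diagonal_iff.2 (stateDiag_nonneg ha ht1), ?_, fun U hU =>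
    posSemidef_PT_conj ha ht ht1 hU⟩
  rw [trace_diagonal_stateDiag]
  exact_mod_cast htr

/-- For `r ^ 2 = 1 / 2`, a reflection mixing the indices `(2, 1)` and `(1, 2)` equally. -/
def halfRotation (r : ℝ) : Matrix QIdx QIdx ℂ := of fun p q =>
  if p = (2, 1) then if q = (2, 1) ∨ q = (1, 2) then (r : ℂ) else 0
  else if p = (1, 2) then
    if q = (2, 1) then (r : ℂ) else if q = (1, 2) then -(r : ℂ) else 0
  else if p = q then 1 else 0

theorem halfRotation_mem {r : ℝ} (hr : (r : ℂ) * r = 1 / 2) :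
    halfRotation r ∈ unitaryGroup QIdx ℂ := by
  rw [mem_unitaryGroup_iff]
  ext ⟨i, j⟩ ⟨k, l⟩
  simp only [star_eq_conjTranspose, mul_apply, conjTranspose_apply, Fintype.sum_prod_type,
    Fin.sum_univ_three, halfRotation, of_apply, one_apply]
  fin_cases i <;> fin_cases j <;> fin_cases k <;> fin_cases l <;> simp [hr] <;> norm_num

/-- A vector of Schmidt rank two in the kernel of a partial transpose of the extreme state. -/
def kerVec (t : ℝ) (p : QIdx) : ℂ := if p = (2, 2) then 1 else if p = (1, 1) then t else 0

theorem PT_mulVec_kerVec (M : Matrix QIdx QIdx ℂ) (t : ℝ) (i j : Fin 3) :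
    (PT M *ᵥ kerVec t) (i, j) = M (i, 2) (2, j) + t * M (i, 1) (1, j) := by
  simp [mulVec, dotProduct, kerVec, PT, Fintype.sum_prod_type, Fin.sum_univ_three]
  ring

theorem dotProduct_PT_kerVec (a t : ℝ) {r : ℝ} (hr : (r : ℂ) * r = 1 / 2) :
    star (kerVec t) ⬝ᵥ
      (PT (halfRotation r * diagonal (stateDiag a t) * (halfRotation r)ᴴ) *ᵥ kerVec t) = 0 := by
  have hψ : ∀ w : QIdx → ℂ, star (kerVec t) ⬝ᵥ w = w (2, 2) + t * w (1, 1) := by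
    intro w
    simp [dotProduct, kerVec, Fintype.sum_prod_type, Fin.sum_univ_three]
    ring
  rw [hψ, PT_mulVec_kerVec, PT_mulVec_kerVec]
  simp only [mul_apply (M := halfRotation r * _), mul_diagonal, conjTranspose_apply]
  simp [halfRotation, stateDiag, Fintype.sum_prod_type, Fin.sum_univ_three]
  linear_combination (-4 * a * t ^ 2) * hr

theorem PT_mulVec_eq_zero_of_combo {x y ρ U : Matrix QIdx QIdx ℂ} (hx : x ∈ AP33) (hy : y ∈ AP33)
    {α β : ℝ} (hα : 0 < α) (hβ : 0 < β) (hxy : α • x + β • y = ρ)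
    (hU : U ∈ unitaryGroup QIdx ℂ) {ψ : QIdx → ℂ}
    (h0 : star ψ ⬝ᵥ (PT (U * ρ * Uᴴ) *ᵥ ψ) = 0) : PT (U * x * Uᴴ) *ᵥ ψ = 0 := by
  have hX := hx.2.2 U hU
  have hY := hy.2.2 U hU
  rw [← hX.dotProduct_mulVec_zero_iff]
  have hlin : PT (U * ρ * Uᴴ) = α • PT (U * x * Uᴴ) + β • PT (U * y * Uᴴ) := by
    rw [← hxy, Matrix.mul_add, Matrix.add_mul, Matrix.mul_smul, Matrix.mul_smul,
      Matrix.smul_mul, Matrix.smul_mul]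
    rfl
  rw [hlin, add_mulVec, smul_mulVec, smul_mulVec, dotProduct_add, dotProduct_smul,
    dotProduct_smul] at h0
  have nx := Complex.nonneg_iff.1 (hX.dotProduct_mulVec_nonneg ψ)
  have ny := Complex.nonneg_iff.1 (hY.dotProduct_mulVec_nonneg ψ)
  have hre := congrArg Complex.re h0
  simp only [Complex.add_re, Complex.smul_re, smul_eq_mul, Complex.zero_re] at hre
  have h1 := mul_nonneg hα.le nx.1
  have h2 := mul_nonneg hβ.le ny.1
  refine Complex.ext ?_ nx.2.symm
  have h3 : α * (star ψ ⬝ᵥ (PT (U * x * Uᴴ) *ᵥ ψ)).re = 0 := by linarith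
  simpa [hα.ne'] using h3

/-- The signed permutation matrix with signs `σ` and permutation `τ`. -/
def signedPerm (σ : QIdx → ℤˣ) (τ : Equiv.Perm QIdx) : Matrix QIdx QIdx ℂ :=
  of fun p q => if q = τ p then ((σ p : ℤ) : ℂ) else 0

theorem signedPerm_conj (σ : QIdx → ℤˣ) (τ : Equiv.Perm QIdx) (x : Matrix QIdx QIdx ℂ)
    (p q : QIdx) :
    (signedPerm σ τ * x * (signedPerm σ τ)ᴴ) p q = (σ p : ℤ) * (σ q : ℤ) * x (τ p) (τ q) := by
  simp only [mul_apply, conjTranspose_apply, signedPerm, of_apply, ite_mul, zero_mul, apply_ite star,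
    star_zero, mul_ite, mul_zero, Finset.sum_ite_eq', Finset.mem_univ, if_true]
  simp
  ring

theorem int_units_mul_self_cast (u : ℤˣ) : ((u : ℤ) : ℂ) * ((u : ℤ) : ℂ) = 1 := by
  rcases Int.units_eq_one_or u with rfl | rfl <;> simp

theorem signedPerm_mem (σ : QIdx → ℤˣ) (τ : Equiv.Perm QIdx) :
    signedPerm σ τ ∈ unitaryGroup QIdx ℂ := by
  rw [mem_unitaryGroup_iff, star_eq_conjTranspose, ← Matrix.mul_one (signedPerm σ τ)]
  ext p q
  rw [conjTranspose_mul, conjTranspose_one, Matrix.one_mul, signedPerm_conj]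
  by_cases h : p = q
  · subst h
    simp [int_units_mul_self_cast]
  · simp [one_apply, h]

theorem signedPerm_conj_stateDiag (a t : ℝ) (σ : QIdx → ℤˣ) {τ : Equiv.Perm QIdx}
    (h1 : τ (2, 1) = (2, 1)) (h2 : τ (2, 2) = (2, 2)) :
    signedPerm σ τ * diagonal (stateDiag a t) * (signedPerm σ τ)ᴴ = diagonal (stateDiag a t) := by
  ext p q
  rw [signedPerm_conj]
  by_cases h : p = q
  · subst h
    have e1 : τ p = (2, 1) ↔ p = (2, 1) := by
      conv_lhs => rw [← h1]
      exact τ.injective.eq_iff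
    have e2 : τ p = (2, 2) ↔ p = (2, 2) := by
      conv_lhs => rw [← h2]
      exact τ.injective.eq_iff
    simp [int_units_mul_self_cast, stateDiag, e1, e2]
  · simp [h]

theorem exists_perm {i j : QIdx} (hij : i ≠ j) (hi1 : i ≠ (2, 1)) (hi2 : i ≠ (2, 2))
    (hj1 : j ≠ (2, 1)) (hj2 : j ≠ (2, 2)) :
    ∃ τ : Equiv.Perm QIdx, τ (1, 1) = i ∧ τ (1, 2) = j ∧ τ (2, 1) = (2, 1) ∧
      τ (2, 2) = (2, 2) := by
  refine ⟨Equiv.swap (1, 1) i * Equiv.swap (1, 2) (Equiv.swap (1, 1) i j), ?_⟩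
  revert i j
  decide

section Face

variable {x y : Matrix QIdx QIdx ℂ} {α β a t r : ℝ}

/-- Kernel equations for an element of the face of the state. -/
theorem face_equations (hr : (r : ℂ) * r = 1 / 2) (hx : x ∈ AP33) (hy : y ∈ AP33)
    (hα : 0 < α) (hβ : 0 < β) (hxy : α • x + β • y = diagonal (stateDiag a t))
    (σ : QIdx → ℤˣ) {τ : Equiv.Perm QIdx}
    (h1 : τ (2, 1) = (2, 1)) (h2 : τ (2, 2) = (2, 2)) (i j : Fin 3) :
    (halfRotation r * (signedPerm σ τ * x * (signedPerm σ τ)ᴴ) * (halfRotation r)ᴴ) (i, 2) (2, j) +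
      t * (halfRotation r * (signedPerm σ τ * x * (signedPerm σ τ)ᴴ) * (halfRotation r)ᴴ) (i, 1) (1, j)
        = 0 := by
  have hmul : ∀ z : Matrix QIdx QIdx ℂ,
      halfRotation r * signedPerm σ τ * z * (halfRotation r * signedPerm σ τ)ᴴ =
        halfRotation r * (signedPerm σ τ * z * (signedPerm σ τ)ᴴ) * (halfRotation r)ᴴ := fun z => by
    simp only [conjTranspose_mul, Matrix.mul_assoc]
  have h := PT_mulVec_eq_zero_of_combo (U := halfRotation r * signedPerm σ τ) (ψ := kerVec t)
    hx hy hα hβ hxy (mul_mem (halfRotation_mem hr) (signedPerm_mem σ τ))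
    (by rw [hmul, signedPerm_conj_stateDiag a t σ h1 h2]; exact dotProduct_PT_kerVec a t hr)
  have h' := congrFun h (i, j)
  rwa [PT_mulVec_kerVec, hmul] at h'

theorem face_entries (hr : (r : ℂ) * r = 1 / 2) (ht : t ≠ 0) (hx : x ∈ AP33) (hy : y ∈ AP33)
    (hα : 0 < α) (hβ : 0 < β) (hxy : α • x + β • y = diagonal (stateDiag a t))
    {f g : QIdx} (hfg : f ≠ g) (hf1 : f ≠ (2, 1)) (hf2 : f ≠ (2, 2))
    (hg1 : g ≠ (2, 1)) (hg2 : g ≠ (2, 2)) :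
    x (2, 2) (2, 2) = t ^ 2 * x f f ∧ x (2, 1) (2, 1) = x g g - 2 * t * x f f ∧
      x (2, 1) (2, 2) = 0 ∧ x g (2, 2) = 0 ∧ x f (2, 1) = 0 ∧ x f g = 0 := by
  obtain ⟨τ, e1, e2, e3, e4⟩ := exists_perm hfg hf1 hf2 hg1 hg2
  have ht' : (t : ℂ) ≠ 0 := by exact_mod_cast ht
  have hr0 : (r : ℂ) ≠ 0 := by
    intro h0
    rw [h0] at hr
    norm_num at hr
  have key := fun (u v : ℤˣ) => face_equations hr hx hy hα hβ hxy
    (fun p => if p = (1, 1) then u else if p = (1, 2) then v else 1) e3 e4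
  have A := fun (u v : ℤˣ) => key u v 2 2
  have B := fun (u v : ℤˣ) => key u v 1 1
  have C := fun (u v : ℤˣ) => key u v 1 2
  simp only [mul_apply (M := halfRotation r * _), mul_apply (M := halfRotation r),
    conjTranspose_apply] at A B C
  simp only [signedPerm_conj] at A B C
  simp [halfRotation, Fintype.sum_prod_type, Fin.sum_univ_three, e1, e2, e3, e4] at A B C
  have A1 := A 1
  have A2 := A (-1)
  have B1 := B 1 1
  have B2 := B 1 (-1)
  have C1 := C 1 1
  have C2 := C 1 (-1)
  have C3 := C (-1) 1
  have C4 := C (-1) (-1)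
  simp only [Units.val_one, Units.val_neg, Int.cast_neg, Int.cast_one] at A1 A2 B1 B2 C1 C2 C3 C4
  refine ⟨?_, ?_, ?_, ?_, ?_, ?_⟩
  · linear_combination (A1 + A2) / 2 - t * (B1 + B2) / 2
  · linear_combination B1 + B2 - 2 * (x (2, 1) (2, 1) - x g g) * hr
  · refine (mul_eq_zero.1 (?_ : (r : ℂ) * x (2, 1) (2, 2) = 0)).resolve_left hr0
    linear_combination (C1 + C2 + C3 + C4) / 4
  · refine (mul_eq_zero.1 (?_ : (r : ℂ) * x g (2, 2) = 0)).resolve_left hr0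
    linear_combination (-C1 + C2 - C3 + C4) / 4
  · refine (mul_eq_zero.1 (?_ : (r * t : ℂ) * x f (2, 1) = 0)).resolve_left (mul_ne_zero hr0 ht')
    linear_combination (C1 + C2 - C3 - C4) / 4
  · refine (mul_eq_zero.1 (?_ : (r * t : ℂ) * x f g = 0)).resolve_left (mul_ne_zero hr0 ht')
    linear_combination (-C1 + C2 + C3 - C4) / 4

end Face

theorem eq_of_combo_eq_stateDiag {x y : Matrix QIdx QIdx ℂ} {α β a t : ℝ} (ht : t ≠ 0)
    (htr : a * (8 - 2 * t + t ^ 2) = 1) (hx : x ∈ AP33) (hy : y ∈ AP33) (hα : 0 < α) (hβ : 0 < β)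
    (hxy : α • x + β • y = diagonal (stateDiag a t)) : x = diagonal (stateDiag a t) := by
  have hr : ((√2 / 2 : ℝ) : ℂ) * ((√2 / 2 : ℝ) : ℂ) = 1 / 2 := by
    rw [← Complex.ofReal_mul, div_mul_div_comm, Real.mul_self_sqrt (by norm_num)]
    norm_num
  have E := fun (f g : QIdx) (hfg : f ≠ g) (hf1 : f ≠ (2, 1)) (hf2 : f ≠ (2, 2))
    (hg1 : g ≠ (2, 1)) (hg2 : g ≠ (2, 2)) =>
      face_entries hr ht hx hy hα hβ hxy hfg hf1 hf2 hg1 hg2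
  have ht' : (t : ℂ) ≠ 0 := by exact_mod_cast ht
  have hH := hx.1.isHermitian
  have hswap : ∀ p q, x p q = 0 → x q p = 0 := fun p q h => by
    rw [← hH.apply, h, star_zero]
  set m := x (0, 0) (0, 0) with hm
  have E0 := E (0, 0) (0, 1) (by decide) (by decide) (by decide) (by decide) (by decide)
  have hdiag : ∀ f : QIdx, f ≠ (2, 1) → f ≠ (2, 2) → x f f = m := by
    intro f h1 h2
    by_cases h0 : f = (0, 0)
    · rw [h0]
    · have e := E f (0, 0) h0 h1 h2 (by decide) (by decide)
      have e' := e.1.symm.trans E0.1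
      exact mul_left_cancel₀ (pow_ne_zero 2 ht') e'
  have h99 : x (2, 2) (2, 2) = t ^ 2 * m := E0.1
  have h88 : x (2, 1) (2, 1) = (1 - 2 * t) * m := by
    rw [E0.2.1, hdiag (0, 1) (by decide) (by decide)]
    ring
  have hpart : ∀ f : QIdx, ∃ g : QIdx, f ≠ g ∧ g ≠ (2, 1) ∧ g ≠ (2, 2) := by decide
  have hoff2 : ∀ p, p ≠ (2, 2) → x p (2, 2) = 0 := by
    intro p hp
    by_cases h : p = (2, 1)
    · rw [h]
      exact E0.2.2.1
    · obtain ⟨g, hg, hg1, hg2⟩ := hpart p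
      exact (E g p hg.symm hg1 hg2 h hp).2.2.2.1
  have hoff1 : ∀ p, p ≠ (2, 1) → x p (2, 1) = 0 := by
    intro p hp
    by_cases h : p = (2, 2)
    · rw [h]
      exact hswap _ _ E0.2.2.1
    · obtain ⟨g, hg, hg1, hg2⟩ := hpart p
      exact (E p g hg hp h hg1 hg2).2.2.2.2.1
  have hoff : ∀ p q, p ≠ q → x p q = 0 := by
    intro p q hpq
    by_cases hq2 : q = (2, 2)
    · subst hq2
      exact hoff2 p hpq
    by_cases hq1 : q = (2, 1)
    · subst hq1
      exact hoff1 p hpq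
    by_cases hp2 : p = (2, 2)
    · subst hp2
      exact hswap _ _ (hoff2 q hq2)
    by_cases hp1 : p = (2, 1)
    · subst hp1
      exact hswap _ _ (hoff1 q hq1)
    exact (E p q hpq hp1 hp2 hq1 hq2).2.2.2.2.2
  have htrx := hx.2.1
  simp only [trace, diag_apply, Fintype.sum_prod_type, Fin.sum_univ_three] at htrx
  rw [h99, h88, hdiag (0, 1) (by decide) (by decide), hdiag (0, 2) (by decide) (by decide),
    hdiag (1, 0) (by decide) (by decide), hdiag (1, 1) (by decide) (by decide),
    hdiag (1, 2) (by decide) (by decide), hdiag (2, 0) (by decide) (by decide), ← hm] at htrx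
  have htr' : (a : ℂ) * (8 - 2 * t + t ^ 2) = 1 := by exact_mod_cast htr
  have hma : m = a := by
    linear_combination a * htrx - m * htr'
  ext p q
  by_cases hpq : p = q
  · subst hpq
    rw [diagonal_apply_eq, stateDiag]
    split_ifs with h2 h1
    · rw [h2, h99, hma, mul_comm]
    · rw [h1, h88, hma, mul_comm]
    · rw [hdiag p h1 h2, hma]
  · rw [hoff p q hpq, diagonal_apply_ne _ hpq]

theorem diagonal_stateDiag_mem_extremePoints {a t : ℝ} (ha : 0 ≤ a) (ht : 0 < t)
    (ht1 : t ^ 2 + 2 * t ≤ 1) (htr : a * (8 - 2 * t + t ^ 2) = 1) :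
    diagonal (stateDiag a t) ∈ Set.extremePoints ℝ AP33 := by
  refine mem_extremePoints_iff_left.2 ⟨diagonal_stateDiag_mem_AP33 ha ht.le ht1 htr, ?_⟩
  rintro x hx y hy ⟨α, β, hα, hβ, -, hxy⟩
  exact eq_of_combo_eq_stateDiag ht.ne' htr hx hy hα hβ hxy

theorem diag9_eq_diagonal_stateDiag {a b c t : ℝ} (hb : b = a * (1 - 2 * t)) (hc : c = a * t ^ 2) :
    diag9 ![a, a, a, a, a, a, a, b, c] = diagonal (stateDiag a t) := by
  subst hb hc
  unfold diag9
  congr 1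
  ext ⟨i, j⟩
  fin_cases i <;> fin_cases j <;> simp [stateDiag, finProdFinEquiv]

/-- for 0 < c < (23−14√2)/137, the state diag(a, a, a, a, a, a, a, b, c) with
a = (4 − 3c + √(8c − 7c²))/32 and b = (4 − 11c − 7√(8c − 7c²))/32 is extreme in AP_{3,3}. -/
theorem nu711_extreme (c : ℝ)
    (h1 : 0 < c) (h2 : c < (23 - 14 * Real.sqrt 2) / 137) :
    diag9 ![(4 - 3 * c + Real.sqrt (8 * c - 7 * c ^ 2)) / 32,
        (4 - 3 * c + Real.sqrt (8 * c - 7 * c ^ 2)) / 32,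
        (4 - 3 * c + Real.sqrt (8 * c - 7 * c ^ 2)) / 32,
        (4 - 3 * c + Real.sqrt (8 * c - 7 * c ^ 2)) / 32,
        (4 - 3 * c + Real.sqrt (8 * c - 7 * c ^ 2)) / 32,
        (4 - 3 * c + Real.sqrt (8 * c - 7 * c ^ 2)) / 32,
        (4 - 3 * c + Real.sqrt (8 * c - 7 * c ^ 2)) / 32,
        (4 - 11 * c - 7 * Real.sqrt (8 * c - 7 * c ^ 2)) / 32, c]
      ∈ Set.extremePoints ℝ AP33 := by
  have hs2 : √2 * √2 = 2 := Real.mul_self_sqrt (by norm_num)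
  have hs2lo : 1.41 ≤ √2 := Real.le_sqrt_of_sq_le (by norm_num)
  have hc : c < 1 / 40 := by linarith
  have hquad : 0 ≤ 137 * c ^ 2 - 46 * c + 1 := by
    have e : 137 * (137 * c ^ 2 - 46 * c + 1) =
        (23 - 137 * c - 14 * √2) * (23 - 137 * c + 14 * √2) := by
      linear_combination 196 * hs2
    have := mul_nonneg (show 0 ≤ 23 - 137 * c - 14 * √2 by linarith)
      (show 0 ≤ 23 - 137 * c + 14 * √2 by linarith)
    linarith
  have hrad : 0 ≤ 8 * c - 7 * c ^ 2 := by nlinarith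
  set s := √(8 * c - 7 * c ^ 2)
  have hs0 : 0 ≤ s := Real.sqrt_nonneg _
  have hss : s * s = 8 * c - 7 * c ^ 2 := Real.mul_self_sqrt hrad
  have hs7 : 7 * s ≤ 4 - 43 * c := by
    refine abs_le_of_sq_le_sq' ?_ (by linarith) |>.2
    nlinarith
  set a := (4 - 3 * c + s) / 32 with ha
  have ha0 : 0 < a := by rw [ha]; linarith
  obtain ⟨t, ht⟩ : ∃ t, t = (c + s) / (8 * a) := ⟨_, rfl⟩
  have hta : a * t = (c + s) / 8 := by rw [ht]; field_simp
  have hb : (4 - 11 * c - 7 * s) / 32 = a * (1 - 2 * t) := by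
    linear_combination 2 * hta - ha
  have hac : c = a * t ^ 2 := by
    refine mul_left_cancel₀ ha0.ne' ?_
    linear_combination c * ha - (a * t + (c + s) / 8) * hta - hss / 64
  have htr : a * (8 - 2 * t + t ^ 2) = 1 := by
    linear_combination 8 * ha - 2 * hta - hac
  have ht0 : 0 < t := by rw [ht]; positivity
  have ht1 : t ^ 2 + 2 * t ≤ 1 := by
    refine le_of_mul_le_mul_left ?_ ha0
    linarith
  rw [diag9_eq_diagonal_stateDiag hb hac]
  exact diagonal_stateDiag_mem_extremePoints ha0.le ht0 ht1 htr
end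
end
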